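/- Let f : ℤ → ℝ be nonnegative with bounded variation, let L be a positive even integer, and let [x,y] be an interval of length L. Let 𝕡_i = {p_i < r_i < q_i}, 1 ≤ i ≤ m, be essential peaks for f satisfying x ≤ p_1 < r_1 < q_1 ≤ p_2 < r_2 < q_2 ≤ … ≤ p_m < r_m < q_m ≤ y (so all peaks lie entirely in [x,y]) and 32L < ω(r_i) ≤ 64L for 1 ≤ i ≤ m. Then there exist integers s < u < v < t such that x − 64L ≤ s, t ≤ y + 64L, u − s ≥ 4L, v − u = L, t − v ≥ 4L, and min{f(s), f(t)} − A_{u,v}f ≥ (1/4) ∑_{i=1}^m Var 𝕡_i. -/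

import Mathlib

open Finset

noncomputable section

/-- Average of `f : ℤ → ℝ` over the integer interval `[x, y]`:
`A_{x,y} f = (1/(y-x+1)) ∑_{k=x}^{y} f(k)`. -/
def avg (f : ℤ → ℝ) (x y : ℤ) : ℝ :=
  (∑ k ∈ Finset.Icc x y, f k) / ((y - x + 1 : ℤ) : ℝ)

/-- The discrete centered Hardy–Littlewood maximal function
`Mf(n) = sup_{r ≥ 0} (1/(2r+1)) ∑_{k=-r}^{r} |f(n+k)|`. -/
def dM (f : ℤ → ℝ) (n : ℤ) : ℝ :=
  ⨆ r : ℕ, avg (fun k => |f k|) (n - r) (n + r)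

/-- The total variation `Var f = ∑_{k ∈ ℤ} |f(k+1) - f(k)|`. -/
def dVar (f : ℤ → ℝ) : ℝ := ∑' k : ℤ, |f (k + 1) - f k|

/-- `f` has bounded variation. -/
def BddVar (f : ℤ → ℝ) : Prop := Summable fun k : ℤ => |f (k + 1) - f k|

/-- A peak for `f`: integers `p < r < q` with `Mf(p) < Mf(r)` and `Mf(q) < Mf(r)`. -/
def IsPeak (f : ℤ → ℝ) (p r q : ℤ) : Prop :=
  p < r ∧ r < q ∧ dM f p < dM f r ∧ dM f q < dM f r

/-- The variation of a peak `{p < r < q}`: `2·Mf(r) - Mf(p) - Mf(q)`. -/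
def peakVar (f : ℤ → ℝ) (p r q : ℤ) : ℝ := 2 * dM f r - dM f p - dM f q

/-- An essential peak: `max_{p<k<q} f(k) ≤ Mf(r) - (1/4)·Var{p,r,q}`. -/
def IsEssentialPeak (f : ℤ → ℝ) (p r q : ℤ) : Prop :=
  IsPeak f p r q ∧
    ∀ k : ℤ, p < k → k < q → f k ≤ dM f r - (1 / 4) * peakVar f p r q

/-- `w` is the radius `ω(r)` of an (essential) peak with center `r`:
the largest integer `w > 0` with `A_w f(r) = Mf(r)`. -/
def IsRadius (f : ℤ → ℝ) (r w : ℤ) : Prop :=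
  0 < w ∧ avg f (r - w) (r + w) = dM f r ∧
    ∀ w' : ℤ, 0 < w' → avg f (r - w') (r + w') = dM f r → w' ≤ w

theorem aux_bdd (f : ℤ → ℝ) (hbv : BddVar f) : ∃ C, ∀ n, |f n| ≤ C := by
  unfold BddVar at hbv
  refine ⟨|f 0| + ∑' k : ℤ, |f (k + 1) - f k|, ?_⟩
  have key : ∀ S : Finset ℤ, ∑ k ∈ S, |f (k + 1) - f k| ≤ ∑' k : ℤ, |f (k + 1) - f k| :=
    fun S => hbv.sum_le_tsum S (fun _ _ => abs_nonneg _)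
  have h1 : ∀ n : ℕ, |f n| ≤ |f 0| + ∑ k ∈ Finset.Ico (0:ℤ) n, |f (k + 1) - f k| := by
    intro n
    induction n with
    | zero => simp
    | succ n ih =>
      have e : Finset.Ico (0:ℤ) ((n + 1 : ℕ) : ℤ) = insert (n:ℤ) (Finset.Ico (0:ℤ) n) := by
        ext k; simp only [Finset.mem_Ico, Finset.mem_insert]; omega
      rw [e, Finset.sum_insert (by simp)]
      have := abs_add_le (f n) (f (n + 1) - f n)
      rw [add_sub_cancel] at this
      push_cast
      linarith
  have h2 : ∀ n : ℕ, |f (-n)| ≤ |f 0| + ∑ k ∈ Finset.Ico (-n : ℤ) 0, |f (k + 1) - f k| := by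
    intro n
    induction n with
    | zero => simp
    | succ n ih =>
      have e : Finset.Ico (-((n + 1 : ℕ) : ℤ)) 0
          = insert (-((n + 1 : ℕ) : ℤ)) (Finset.Ico (-n:ℤ) 0) := by
        ext k; simp; omega
      rw [e, Finset.sum_insert (by simp)]
      have e2 : -((n + 1 : ℕ) : ℤ) + 1 = -n := by push_cast; ring
      rw [e2]
      have := abs_sub_abs_le_abs_sub (f (-((n + 1 : ℕ) : ℤ))) (f (-n))
      rw [abs_sub_comm] at this
      linarith
  intro n
  rcases Int.eq_nat_or_neg n with ⟨k, rfl | rfl⟩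
  · linarith [h1 k, key (Finset.Ico (0:ℤ) k)]
  · linarith [h2 k, key (Finset.Ico (-k:ℤ) 0)]

theorem aux_avg_le (f : ℤ → ℝ) (hf : ∀ n, 0 ≤ f n) (hbv : BddVar f) (n w : ℤ) (hw : 0 ≤ w) :
    ∑ k ∈ Finset.Icc (n - w) (n + w), f k ≤ (2 * w + 1) * dM f n := by
  obtain ⟨C, hC⟩ := aux_bdd f hbv
  lift w to ℕ using hw
  have hb : BddAbove (Set.range fun r : ℕ => avg (fun k => |f k|) (n - r) (n + r)) := by
    refine ⟨C, ?_⟩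
    rintro _ ⟨r, rfl⟩
    simp only [avg]
    have hp : (0:ℝ) < ((n + r - (n - r) + 1 : ℤ) : ℝ) := by
      have : 0 < n + r - (n - r) + 1 := by omega
      exact_mod_cast this
    rw [div_le_iff₀ hp]
    have := Finset.sum_le_card_nsmul (Finset.Icc (n - (r:ℤ)) (n + r)) (fun k => |f k|) C
      (fun k _ => hC k)
    have e : ((Finset.Icc (n - (r:ℤ)) (n + r)).card : ℝ) = ((n + r - (n - r) + 1 : ℤ) : ℝ) := by
      have : ((Finset.Icc (n - (r:ℤ)) (n + r)).card : ℤ) = (n + r - (n - r) + 1 : ℤ) := by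
        rw [Int.card_Icc]; omega
      exact_mod_cast this
    rw [nsmul_eq_mul, e] at this
    linarith
  have h := le_ciSup hb w
  change _ ≤ dM f n at h
  simp only [avg, abs_of_nonneg (hf _)] at h
  have hp : (0:ℝ) < 2 * (w:ℝ) + 1 := by positivity
  have e : ((n + w - (n - w) + 1 : ℤ) : ℝ) = 2 * (w:ℝ) + 1 := by push_cast; ring
  rw [e, div_le_iff₀ hp] at h
  push_cast
  linarith

theorem aux_exists (f : ℤ → ℝ) (a b : ℤ) (hab : a ≤ b) (c : ℝ)
    (h : (b - a + 1) * c ≤ ∑ k ∈ Finset.Icc a b, f k) : ∃ t, a ≤ t ∧ t ≤ b ∧ c ≤ f t := by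
  have e : ((Finset.Icc a b).card : ℝ) = b - a + 1 := by
    have : ((Finset.Icc a b).card : ℤ) = b - a + 1 := by
      rw [Int.card_Icc]; omega
    exact_mod_cast this
  obtain ⟨t, ht, hct⟩ := Finset.exists_le_of_sum_le (s := Finset.Icc a b) (f := fun _ => c) (g := f)
    ⟨a, by simp [hab]⟩ (by rw [Finset.sum_const, nsmul_eq_mul, e]; exact h)
  rw [Finset.mem_Icc] at ht
  exact ⟨t, ht.1, ht.2, hct⟩

theorem aux_split (f : ℤ → ℝ) (a b c : ℤ) (h1 : a ≤ b) (h2 : b ≤ c) :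
    ∑ k ∈ Finset.Icc a c, f k = ∑ k ∈ Finset.Icc a b, f k + ∑ k ∈ Finset.Icc (b+1) c, f k := by
  rw [← Finset.sum_union]
  · congr 1; ext k; simp; omega
  · rw [Finset.disjoint_left]; intro k; simp; omega

theorem aux_rad (f : ℤ → ℝ) (r w : ℤ) (h : IsRadius f r w) :
    ∑ k ∈ Finset.Icc (r - w) (r + w), f k = (2 * w + 1) * dM f r := by
  obtain ⟨h0, h1, _⟩ := h
  rw [← h1, avg]
  have : (0:ℝ) < w := by exact_mod_cast h0
  have e : ((r + w - (r - w) + 1 : ℤ) : ℝ) = 2 * (w:ℝ) + 1 := by push_cast; ring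
  rw [e]; field_simp

theorem aux_num (L l w D Dn T : ℝ) (hl : 0 < l) (hlL : l ≤ L) (hw : 32 * L ≤ w)
    (hD : Dn ≤ D) (c : ℝ) (hc : l * c ≤ 31 * L * (D - Dn))
    (h : (2 * w + 1) * D ≤ (2 * (w - l) + 1) * Dn + T) : (2 * l) * (D + c) ≤ T := by
  have : 62 * L * (D - Dn) ≤ (2 * (w - l) + 1) * (D - Dn) :=
    mul_le_mul_of_nonneg_right (by linarith) (by linarith)
  nlinarith

theorem aux_right (f : ℤ → ℝ) (hf : ∀ n, 0 ≤ f n) (hbv : BddVar f) (L n r w : ℤ)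
    (hn : n < r) (hl : r - n ≤ L) (hw : 32 * L < w) (hr : IsRadius f r w)
    (hD : dM f n ≤ dM f r) (c : ℝ) (hc : (r - n : ℝ) * c ≤ 31 * L * (dM f r - dM f n)) :
    ∃ t, 2 * n - r + w + 1 ≤ t ∧ t ≤ r + w ∧ dM f r + c ≤ f t := by
  have h1 := aux_rad f r w hr
  have h2 := aux_avg_le f hf hbv n (w - (r - n)) (by omega)
  have h3 := aux_split f (r - w) (n + (w - (r - n))) (r + w) (by omega) (by omega)
  rw [show n - (w - (r - n)) = r - w by ring] at h2
  obtain ⟨t, ht⟩ := aux_exists f (n + (w - (r - n)) + 1) (r + w) (by omega) (dM f r + c) (by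
    push_cast at h2 ⊢
    have := aux_num L (r - n) w (dM f r) (dM f n)
      (∑ k ∈ Finset.Icc (n + (w - (r - n)) + 1) (r + w), f k)
      (by exact_mod_cast (by omega : 0 < r - n)) (by exact_mod_cast hl) (by exact_mod_cast hw.le)
      hD c hc (by linarith)
    calc _ = _ := by ring
      _ ≤ _ := this)
  exact ⟨t, by omega, ht.2⟩

theorem aux_left (f : ℤ → ℝ) (hf : ∀ n, 0 ≤ f n) (hbv : BddVar f) (L n r w : ℤ)
    (hn : r < n) (hl : n - r ≤ L) (hw : 32 * L < w) (hr : IsRadius f r w)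
    (hD : dM f n ≤ dM f r) (c : ℝ) (hc : (n - r : ℝ) * c ≤ 31 * L * (dM f r - dM f n)) :
    ∃ t, r - w ≤ t ∧ t ≤ 2 * n - r - w - 1 ∧ dM f r + c ≤ f t := by
  have h1 := aux_rad f r w hr
  have h2 := aux_avg_le f hf hbv n (w - (n - r)) (by omega)
  have h3 := aux_split f (r - w) (n - (w - (n - r)) - 1) (r + w) (by omega) (by omega)
  rw [show n + (w - (n - r)) = r + w by ring] at h2
  rw [sub_add_cancel] at h3
  obtain ⟨t, ht⟩ := aux_exists f (r - w) (n - (w - (n - r)) - 1) (by omega) (dM f r + c) (by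
    push_cast at h2 ⊢
    have := aux_num L (n - r) w (dM f r) (dM f n)
      (∑ k ∈ Finset.Icc (r - w) (n - (w - (n - r)) - 1), f k)
      (by exact_mod_cast (by omega : 0 < n - r)) (by exact_mod_cast hl) (by exact_mod_cast hw.le)
      hD c hc (by linarith)
    calc _ = _ := by ring
      _ ≤ _ := this)
  exact ⟨t, ht.1, by omega, ht.2.2⟩

theorem aux_pigeon (m : ℕ) (hm : 1 ≤ m) (a l : ℕ → ℝ) (L : ℝ) (hL : 0 < L)
    (ha : ∀ i < m, 0 ≤ a i) (hl : ∑ i ∈ Finset.range m, l i ≤ L) :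
    ∃ i < m, l i * (31 * ∑ i ∈ Finset.range m, a i) ≤ 31 * L * a i := by
  have h0 : 0 ≤ ∑ i ∈ Finset.range m, a i :=
    Finset.sum_nonneg (fun i hi => ha i (Finset.mem_range.1 hi))
  obtain ⟨i, hi, h⟩ := Finset.exists_le_of_sum_le (s := Finset.range m)
    (f := fun i => l i * (31 * ∑ i ∈ Finset.range m, a i)) (g := fun i => 31 * L * a i)
    ⟨0, by simp; omega⟩ (by
      rw [← Finset.sum_mul, ← Finset.mul_sum]; nlinarith)
  exact ⟨i, Finset.mem_range.1 hi, h⟩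

theorem aux_core (f : ℤ → ℝ) (hf : ∀ n, 0 ≤ f n) (hbv : BddVar f)
    (L x y : ℤ) (hL : 0 < L) (hLeven : Even L) (hxy : y = x + L)
    (m : ℕ) (hm : 1 ≤ m) (z ρ w : ℕ → ℤ)
    (h1 : ∀ i < m, z i < ρ i) (h2 : ∀ i < m, ρ i < z (i + 1))
    (h3 : ∀ i < m, dM f (z i) ≤ dM f (ρ i)) (h4 : ∀ i < m, dM f (z (i+1)) ≤ dM f (ρ i))
    (hw : ∀ i < m, IsRadius f (ρ i) (w i)) (hw1 : ∀ i < m, 32 * L < w i)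
    (hw2 : ∀ i < m, w i ≤ 64 * L) (hx : x ≤ z 0) (hy : z m ≤ y) :
    ∃ s u v t : ℤ, s < u ∧ u < v ∧ v < t ∧
      x - 64 * L ≤ s ∧ t ≤ y + 64 * L ∧
      4 * L ≤ u - s ∧ v - u = L ∧ 4 * L ≤ t - v ∧
      min (f s) (f t) - avg f u v ≥
        (1 / 4 : ℝ) * ∑ i ∈ Finset.range m,
          ((dM f (ρ i) - dM f (z i)) + (dM f (ρ i) - dM f (z (i+1)))) := by
  have hzl : ∀ i ≤ m, x ≤ z i := by
    intro i
    induction i with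
    | zero => intro _; exact hx
    | succ i ih => intro hi; linarith [ih (by omega), h1 i (by omega), h2 i (by omega)]
  have hzu : ∀ j ≤ m, z (m - j) ≤ y := by
    intro j
    induction j with
    | zero => intro _; exact hy
    | succ j ih =>
      intro hj
      have e : m - (j + 1) + 1 = m - j := by omega
      have := h2 (m - (j+1)) (by omega)
      rw [e] at this
      linarith [ih (by omega), h1 (m - (j+1)) (by omega)]
  have hzu' : ∀ i ≤ m, z i ≤ y := by
    intro i hi
    have := hzu (m - i) (by omega)
    rwa [show m - (m - i) = i by omega] at this
  obtain ⟨k, hk, hmin⟩ := Finset.exists_min_image (Finset.range (m+1)) (fun i => dM f (z i))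
    ⟨0, by simp⟩
  have hk' : k ≤ m := by simp at hk; omega
  have hmin' : ∀ i ≤ m, dM f (z k) ≤ dM f (z i) := fun i hi => hmin i (by simp; omega)
  set a := ∑ i ∈ Finset.range m, (dM f (ρ i) - dM f (z i)) with ha
  set b := ∑ i ∈ Finset.range m, (dM f (ρ i) - dM f (z (i+1))) with hb
  have hab : a - b = dM f (z m) - dM f (z 0) := by
    rw [ha, hb, ← Finset.sum_sub_distrib, ← Finset.sum_range_sub (fun i => dM f (z i))]
    exact Finset.sum_congr rfl (fun i _ => by ring)
  have ha0 : 0 ≤ a := Finset.sum_nonneg fun i hi => by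
    linarith [h3 i (Finset.mem_range.1 hi)]
  have hb0 : 0 ≤ b := Finset.sum_nonneg fun i hi => by
    linarith [h4 i (Finset.mem_range.1 hi)]
  have hLr : (0:ℝ) < L := by exact_mod_cast hL
  have hz : ((z m : ℝ) - z 0) ≤ L := by exact_mod_cast (by omega : z m - z 0 ≤ L)
  have T1 : ∃ t, y + 5 * L ≤ t ∧ t ≤ y + 64 * L ∧ dM f (z k) + 31 * a ≤ f t := by
    obtain ⟨i, hi, h⟩ := aux_pigeon m hm (fun i => dM f (ρ i) - dM f (z i))
      (fun i => (ρ i - z i : ℝ)) L hLr (fun i hi => by linarith [h3 i hi]) (by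
        refine le_trans ?_ hz
        rw [← Finset.sum_range_sub (fun i => (z i : ℝ))]
        refine Finset.sum_le_sum fun i hi => ?_
        have : (ρ i : ℝ) < z (i+1) := by exact_mod_cast h2 i (Finset.mem_range.1 hi)
        linarith)
    have b1 := hzl i (by omega)
    have b2 := hzu' (i+1) (by omega)
    have b3 := h1 i hi
    have b4 := h2 i hi
    have b5 := hw1 i hi
    have b6 := hw2 i hi
    obtain ⟨t, t1, t2, t3⟩ := aux_right f hf hbv L (z i) (ρ i) (w i) b3 (by omega) b5 (hw i hi)
      (h3 i hi) _ h
    exact ⟨t, by omega, by omega, by linarith [hmin' i (by omega), h3 i hi]⟩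
  have S1 : ∃ t, t ≤ x - 5 * L ∧ x - 64 * L ≤ t ∧ dM f (z k) + 31 * b ≤ f t := by
    obtain ⟨i, hi, h⟩ := aux_pigeon m hm (fun i => dM f (ρ i) - dM f (z (i+1)))
      (fun i => (z (i+1) - ρ i : ℝ)) L hLr (fun i hi => by linarith [h4 i hi]) (by
        refine le_trans ?_ hz
        rw [← Finset.sum_range_sub (fun i => (z i : ℝ))]
        refine Finset.sum_le_sum fun i hi => ?_
        have : (z i : ℝ) < ρ i := by exact_mod_cast h1 i (Finset.mem_range.1 hi)
        linarith)
    have b1 := hzl i (by omega)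
    have b2 := hzu' (i+1) (by omega)
    have b3 := h1 i hi
    have b4 := h2 i hi
    have b5 := hw1 i hi
    have b6 := hw2 i hi
    obtain ⟨t, t1, t2, t3⟩ := aux_left f hf hbv L (z (i+1)) (ρ i) (w i) b4 (by omega) b5 (hw i hi)
      (h4 i hi) _ h
    exact ⟨t, by omega, by omega, by linarith [hmin' i (by omega), h3 i hi]⟩
  have T2 : ∃ t, y + 5 * L ≤ t ∧ t ≤ y + 64 * L ∧ dM f (z 0) ≤ f t := by
    have hi : 0 < m := hm
    have b1 := hzl 0 (by omega)
    have b2 := hzu' (0+1) (by omega)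
    have b3 := h1 0 hi
    have b4 := h2 0 hi
    have b5 := hw1 0 hi
    have b6 := hw2 0 hi
    obtain ⟨t, t1, t2, t3⟩ := aux_right f hf hbv L (z 0) (ρ 0) (w 0) b3 (by omega) b5 (hw 0 hi)
      (h3 0 hi) 0 (by rw [mul_zero]; exact mul_nonneg (by positivity) (by linarith [h3 0 hi]))
    exact ⟨t, by omega, by omega, by linarith [h3 0 hi]⟩
  have S2 : ∃ t, t ≤ x - 5 * L ∧ x - 64 * L ≤ t ∧ dM f (z m) ≤ f t := by
    obtain ⟨i, rfl⟩ : ∃ i, m = i + 1 := ⟨m - 1, by omega⟩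
    have hi : i < i + 1 := by omega
    have b1 := hzl i (by omega)
    have b2 := hzu' (i+1) (by omega)
    have b3 := h1 i hi
    have b4 := h2 i hi
    have b5 := hw1 i hi
    have b6 := hw2 i hi
    obtain ⟨t, t1, t2, t3⟩ := aux_left f hf hbv L (z (i+1)) (ρ i) (w i) b4 (by omega) b5 (hw i hi)
      (h4 i hi) 0 (by rw [mul_zero]; exact mul_nonneg (by positivity) (by linarith [h4 i hi]))
    exact ⟨t, by omega, by omega, by linarith [h4 i hi]⟩
  have T : ∃ t, y + 5 * L ≤ t ∧ t ≤ y + 64 * L ∧ dM f (z k) + 1/4 * (a + b) ≤ f t := by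
    obtain ⟨t, t1, t2, t3⟩ := T1
    obtain ⟨t', t1', t2', t3'⟩ := T2
    by_cases h : a + b ≤ 124 * a
    · exact ⟨t, t1, t2, by linarith⟩
    · exact ⟨t', t1', t2', by linarith [hmin' m le_rfl]⟩
  have S : ∃ t, t ≤ x - 5 * L ∧ x - 64 * L ≤ t ∧ dM f (z k) + 1/4 * (a + b) ≤ f t := by
    obtain ⟨t, t1, t2, t3⟩ := S1
    obtain ⟨t', t1', t2', t3'⟩ := S2
    by_cases h : a + b ≤ 124 * b
    · exact ⟨t, t1, t2, by linarith⟩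
    · exact ⟨t', t1', t2', by linarith [hmin' 0 (by omega)]⟩
  obtain ⟨t, t1, t2, t3⟩ := T
  obtain ⟨s, s1, s2, s3⟩ := S
  obtain ⟨e, he⟩ := hLeven
  have c1 := hzl k hk'
  have c2 := hzu' k hk'
  refine ⟨s, z k - e, z k + e, t, by omega, by omega, by omega, by omega, by omega, by omega,
    by omega, by omega, ?_⟩
  have hA : avg f (z k - e) (z k + e) ≤ dM f (z k) := by
    have := aux_avg_le f hf hbv (z k) e (by omega)
    have he0 : (0:ℝ) < e := by exact_mod_cast (by omega : 0 < e)
    have e' : ((z k + e - (z k - e) + 1 : ℤ) : ℝ) = 2 * (e:ℝ) + 1 := by push_cast; ring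
    rw [avg, e', div_le_iff₀ (by positivity)]
    linarith
  rw [Finset.sum_add_distrib]
  have := le_min s3 t3
  linarith

/-- the case of Lemma 2 where all the peaks lie entirely in `[x,y]`,
with constant `1/4`. -/
theorem stmt5 (f : ℤ → ℝ) (hf : ∀ n, 0 ≤ f n) (hbv : BddVar f)
    (L x y : ℤ) (hL : 0 < L) (hLeven : Even L) (hxy : y = x + L)
    (m : ℕ) (hm : 1 ≤ m) (p r q ω : ℕ → ℤ)
    (hpk : ∀ i ∈ Finset.Icc 1 m, IsEssentialPeak f (p i) (r i) (q i))
    (hrad : ∀ i ∈ Finset.Icc 1 m, IsRadius f (r i) (ω i))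
    (hωlb : ∀ i ∈ Finset.Icc 1 m, 32 * L < ω i)
    (hωub : ∀ i ∈ Finset.Icc 1 m, ω i ≤ 64 * L)
    (hx : x ≤ p 1) (hy : q m ≤ y)
    (hchain : ∀ i ∈ Finset.Icc 1 (m - 1), q i ≤ p (i + 1)) :
    ∃ s u v t : ℤ, s < u ∧ u < v ∧ v < t ∧
      x - 64 * L ≤ s ∧ t ≤ y + 64 * L ∧
      4 * L ≤ u - s ∧ v - u = L ∧ 4 * L ≤ t - v ∧
      min (f s) (f t) - avg f u v ≥
        (1 / 4 : ℝ) * ∑ i ∈ Finset.Icc 1 m, peakVar f (p i) (r i) (q i) := by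
  classical
  let z : ℕ → ℤ := fun i => if i = 0 then p 1 else if i = m then q m else
    if dM f (q i) ≤ dM f (p (i+1)) then q i else p (i+1)
  have hI : ∀ i < m, i + 1 ∈ Finset.Icc 1 m := fun i hi => by simp; omega
  have hzp : ∀ i < m, z i ≤ p (i+1) ∧ dM f (z i) ≤ dM f (p (i+1)) := by
    intro i hi
    simp only [z]
    by_cases h0 : i = 0
    · subst h0; simp
    · have := hchain i (by simp; omega)
      rw [if_neg h0, if_neg (by omega)]
      split_ifs with h
      · exact ⟨this, h⟩
      · exact ⟨le_rfl, le_rfl⟩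
  have hzq : ∀ i < m, q (i+1) ≤ z (i+1) ∧ dM f (z (i+1)) ≤ dM f (q (i+1)) := by
    intro i hi
    simp only [z]
    rw [if_neg (by omega)]
    by_cases h0 : i + 1 = m
    · rw [if_pos h0, h0]; exact ⟨le_rfl, le_rfl⟩
    · have := hchain (i+1) (by simp; omega)
      rw [if_neg h0]
      split_ifs with h
      · exact ⟨le_rfl, le_rfl⟩
      · exact ⟨this, (not_le.1 h).le⟩
  have hz0 : z 0 = p 1 := by simp [z]
  have hzm : z m = q m := by
    simp only [z]; rw [if_neg (by omega)]; simp
  obtain ⟨s, u, v, t, k1, k2, k3, k4, k5, k6, k7, k8, k9⟩ :=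
    aux_core f hf hbv L x y hL hLeven hxy m hm z (fun i => r (i+1)) (fun i => ω (i+1))
      (fun i hi => lt_of_le_of_lt (hzp i hi).1 (hpk _ (hI i hi)).1.1)
      (fun i hi => lt_of_lt_of_le (hpk _ (hI i hi)).1.2.1 (hzq i hi).1)
      (fun i hi => (hzp i hi).2.trans (hpk _ (hI i hi)).1.2.2.1.le)
      (fun i hi => (hzq i hi).2.trans (hpk _ (hI i hi)).1.2.2.2.le)
      (fun i hi => hrad _ (hI i hi)) (fun i hi => hωlb _ (hI i hi)) (fun i hi => hωub _ (hI i hi))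
      (by rw [hz0]; exact hx) (by rw [hzm]; exact hy)
  refine ⟨s, u, v, t, k1, k2, k3, k4, k5, k6, k7, k8, le_trans ?_ k9⟩
  have e : Finset.Icc 1 m = Finset.Ico 1 (m+1) := by ext i; simp only [Finset.mem_Ico, Finset.mem_Icc]; omega
  rw [e, Finset.sum_Ico_eq_sum_range]
  refine mul_le_mul_of_nonneg_left ?_ (by norm_num)
  rw [Nat.add_sub_cancel]
  refine Finset.sum_le_sum fun i hi => ?_
  have hi' := Finset.mem_range.1 hi
  rw [add_comm 1 i, peakVar]
  linarith [(hzp i hi').2, (hzq i hi').2]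

end
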